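/- Fix m ∈ ℕ₀ and let −1 ≤ a < b ≤ 1. Then lim_{n→∞} #{(k,i) : −n ≤ k ≤ n, 1 ≤ i ≤ N_k, x_{|k|,i} ∈ [a,b]} / N_n^m = (b−a)/2; that is, the distribution of the eigenvalues x_{|k|,i} converges weakly to the uniform distribution on [−1,1] as n → ∞. -/

import Mathlib

open MeasureTheory Finset

noncomputable section

namespace SFT

/-- The recurrence coefficients `b_l^{(α)}` of the orthonormal ultraspherical polynomials. -/
def b (α : ℝ) : ℕ → ℝ
  | 0 => Real.sqrt (Real.sqrt Real.pi * Real.Gamma (α + 1) / (2 * Real.Gamma (α + 3 / 2)))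
  | l + 1 => Real.sqrt ((((l : ℝ) + 1) * (((l : ℝ) + 1) + 2 * α)) /
      ((2 * ((l : ℝ) + 1) + 2 * α + 1) * (2 * ((l : ℝ) + 1) + 2 * α - 1)))

/-- The associated ultraspherical polynomials: `pA α m l x = p_l^{(α)}(x, m)`.
For `m = 0` these are the orthonormal ultraspherical polynomials `p_l^{(α)}(x)`. -/
def pA (α : ℝ) (m : ℕ) : ℕ → ℝ → ℝ
  | 0, _ => 1 / b α m
  | 1, x => x * (1 / b α m) / b α (m + 1)
  | l + 2, x => (x * pA α m (l + 1) x - b α (m + l + 1) * pA α m l x) / b α (m + l + 2)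

/-- The orthonormal ultraspherical polynomials `p_l^{(α)}(x)`. -/
def p (α : ℝ) (l : ℕ) (x : ℝ) : ℝ := pA α 0 l x

/-- Ultraspherical polynomials with integer index; in particular `p_{-1}^{(α)} = 0`. -/
def pZ (α : ℝ) (l : ℤ) (x : ℝ) : ℝ := if 0 ≤ l then p α l.toNat x else 0

/-- `JE α M i j` is the `(i,j)` entry (`0`-based) of the truncated Jacobi matrix
`J(α)_L^M` (of any size `L − M + 1`). -/
def JE (α : ℝ) (M : ℕ) (i j : ℕ) : ℝ :=
  if i + 1 = j then b α (M + i + 1) else if j + 1 = i then b α (M + j + 1) else 0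

/-- The truncated Jacobi matrix `J(α)_{M+l}^M`, of size `(l+1) × (l+1)`.
In particular `Jt α 0 l` is the Jacobi matrix `J(α)_l`. -/
def Jt (α : ℝ) (M l : ℕ) : Matrix (Fin (l + 1)) (Fin (l + 1)) ℝ :=
  fun i j => JE α M i.1 j.1

/-- The spherical harmonics `Y_l^k(θ, φ)`. -/
def Y (l : ℕ) (k : ℤ) (θ φ : ℝ) : ℂ :=
  ((Real.sin θ ^ k.natAbs : ℝ) : ℂ) * ((p (k.natAbs : ℝ) (l - k.natAbs) (Real.cos θ) : ℝ) : ℂ) *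
    Complex.exp (Complex.I * (k : ℂ) * (φ : ℂ))

/-- Parameter region `[0, π] × [0, 2π]` of spherical coordinates. -/
def region : Set (ℝ × ℝ) := Set.Icc (0 : ℝ) Real.pi ×ˢ Set.Icc (0 : ℝ) (2 * Real.pi)

/-- The inner product of `L²(S²)`. -/
def inner2 (f g : ℝ → ℝ → ℂ) : ℂ :=
  (1 / (4 * Real.pi)) *
    ∫ q in region, f q.1 q.2 * (starRingEnd ℂ) (g q.1 q.2) * ((Real.sin q.1 : ℝ) : ℂ)

/-- The norm of `L²(S²)`. -/
def norm2 (f : ℝ → ℝ → ℂ) : ℝ := Real.sqrt (inner2 f f).re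

/-- Membership in `L²(S²)`. -/
def MemL2 (f : ℝ → ℝ → ℂ) : Prop :=
  Measurable (fun q : ℝ × ℝ => f q.1 q.2) ∧
    IntegrableOn (fun q : ℝ × ℝ => ‖f q.1 q.2‖ ^ 2 * Real.sin q.1) region

/-- The multiplication operator `M`. -/
def Mop (f : ℝ → ℝ → ℂ) : ℝ → ℝ → ℂ := fun θ φ => ((Real.cos θ : ℝ) : ℂ) * f θ φ

/-- The power `M^j` of the multiplication operator. -/
def Mpow (j : ℕ) (f : ℝ → ℝ → ℂ) : ℝ → ℝ → ℂ := fun θ φ => ((Real.cos θ : ℝ) : ℂ) ^ j * f θ φ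

/-- The mean value `ε(f)`. -/
def eps (f : ℝ → ℝ → ℂ) : ℝ :=
  (1 / (4 * Real.pi)) * ∫ q in region, Real.cos q.1 * ‖f q.1 q.2‖ ^ 2 * Real.sin q.1

/-- The projection `P_n^m` onto `Π_n^m`. -/
def Pr (n m : ℕ) (f : ℝ → ℝ → ℂ) : ℝ → ℝ → ℂ :=
  fun θ φ => ∑ l ∈ Finset.Icc m n, ∑ k ∈ Finset.Icc (-(l : ℤ)) (l : ℤ),
    inner2 f (Y l k) * Y l k θ φ

/-- The space–frequency operator `P_n^m M P_n^m`. -/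
def SFop (n m : ℕ) (f : ℝ → ℝ → ℂ) : ℝ → ℝ → ℂ := Pr n m (Mop (Pr n m f))

/-- The space `Π_n^m`, spanned by the spherical harmonics `Y_l^k`, `m ≤ l ≤ n`, `|k| ≤ l`. -/
def Pi_nm (n m : ℕ) : Submodule ℂ (ℝ → ℝ → ℂ) :=
  Submodule.span ℂ {g | ∃ l : ℕ, ∃ k : ℤ, m ≤ l ∧ l ≤ n ∧ k.natAbs ≤ l ∧ g = Y l k}

/-- `N_k = n − max(|k|, m) + 1`. -/
def Nk (n m k : ℕ) : ℕ := n - max k m + 1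

/-- The normalizing constant `κ_{k,i}`, given the corresponding root value `xr`. -/
def kap (n m k : ℕ) (xr : ℝ) : ℝ :=
  (Real.sqrt (∑ l ∈ Finset.Icc (max k m) n, (pA (k : ℝ) (m - k) (l - max k m) xr) ^ 2))⁻¹

/-- The eigenfunction `ψ_{k,i}`, given the corresponding root value `xr`. -/
def psiFun (n m : ℕ) (k : ℤ) (xr : ℝ) : ℝ → ℝ → ℂ :=
  fun θ φ => ((kap n m k.natAbs xr : ℝ) : ℂ) *
    ∑ l ∈ Finset.Icc (max k.natAbs m) n,
      ((pA (k.natAbs : ℝ) (m - k.natAbs) (l - max k.natAbs m) xr : ℝ) : ℂ) * Y l k θ φ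


/-- Number of walks of length `j` on `ℤ` with displacement `d`. -/
def cW : ℕ → ℤ → ℝ
  | 0, d => if d = 0 then 1 else 0
  | j + 1, d => cW j (d - 1) + cW j (d + 1)

lemma cW_zero_of_gt (j : ℕ) : ∀ d : ℤ, (j : ℤ) < |d| → cW j d = 0 := by
  induction j with
  | zero => intro d hd; simp at hd; simp [cW, hd]
  | succ j ih =>
    intro d hd
    rw [cW, ih, ih, add_zero]
    · push_cast at hd; grind
    · push_cast at hd; grind

lemma cW_odd (j : ℕ) : ∀ d : ℤ, (j + d) % 2 = 1 → cW j d = 0 := by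
  induction j with
  | zero => intro d hd; have : d ≠ 0 := by rintro rfl; simp at hd
            simp [cW, this]
  | succ j ih =>
    intro d hd
    rw [cW, ih, ih, add_zero]
    · push_cast at hd; omega
    · push_cast at hd; omega

lemma cW_choose (j : ℕ) : ∀ r : ℕ, cW j (2 * r - j) = (j.choose r : ℝ) := by
  induction j with
  | zero => intro r; rcases r with _ | r
            · simp [cW]
            · have : (2 * ((r + 1 : ℕ) : ℤ) - ((0:ℕ) : ℤ)) ≠ 0 := by push_cast; omega
              rw [cW, if_neg this]; simp
  | succ j ih =>
    intro r
    rw [cW]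
    rcases r with _ | r
    · rw [cW_zero_of_gt]
      · have := ih 0
        simp only [Nat.choose_zero_right] at this ⊢
        rw [← this, zero_add]; congr 1; push_cast; ring
      · push_cast; grind
    · rw [Nat.choose_succ_succ]
      push_cast
      rw [← ih r, ← ih (r + 1)]
      congr 2 <;> push_cast <;> ring

lemma cW_even (s : ℕ) : cW (2 * s) 0 = (s.centralBinom : ℝ) := by
  rw [Nat.centralBinom, ← cW_choose]; congr 1; push_cast; ring

lemma shift_nat (B : ℤ → ℝ) (hV : ∀ s : Finset ℤ, ∑ i ∈ s, |B (i + 1) - B i| ≤ 1) (d : ℕ) :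
    ∀ s : Finset ℤ, ∑ i ∈ s, |B (i + d) - B i| ≤ d := by
  induction d with
  | zero => intro s; simp
  | succ d ih =>
    intro s
    have h1 : ∑ i ∈ s, |B (i + d + 1) - B (i + d)| ≤ 1 := by
      have := hV (s.map (addRightEmbedding (d : ℤ)))
      simpa using this
    calc ∑ i ∈ s, |B (i + (d + 1 : ℕ)) - B i|
        ≤ ∑ i ∈ s, (|B (i + d + 1) - B (i + d)| + |B (i + d) - B i|) := by
          apply Finset.sum_le_sum; intro i _
          have e : i + ((d + 1 : ℕ) : ℤ) = i + d + 1 := by push_cast; ring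
          rw [e]; exact abs_sub_le _ _ _
      _ ≤ _ := by rw [Finset.sum_add_distrib]; push_cast; linarith [ih s]

lemma shift_int (B : ℤ → ℝ) (hV : ∀ s : Finset ℤ, ∑ i ∈ s, |B (i + 1) - B i| ≤ 1) (d : ℤ)
    (s : Finset ℤ) : ∑ i ∈ s, |B (i + d) - B i| ≤ (d.natAbs : ℝ) := by
  rcases Int.natAbs_eq d with h | h
  · have := shift_nat B hV d.natAbs s
    rwa [← h] at this
  · have := shift_nat B hV d.natAbs (s.map (addRightEmbedding d))
    have e : (d.natAbs : ℤ) = -d := by omega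
    simp only [Finset.sum_map, addRightEmbedding_apply, e, add_neg_cancel_right] at this
    convert this using 2
    exact abs_sub_comm _ _

lemma walk_bound (j : ℕ) : ∀ d : ℤ, ∃ C : ℝ, 0 ≤ C ∧ ∀ (B : ℤ → ℝ) (W : ℕ → ℤ → ℤ → ℝ) (s : Finset ℤ),
    (∀ i, |B i| ≤ 1) → (∀ s : Finset ℤ, ∑ i ∈ s, |B (i + 1) - B i| ≤ 1) →
    (∀ i ∈ s, ∀ l, W 0 i l = if i = l then 1 else 0) →
    (∀ j, ∀ i ∈ s, ∀ l, W (j + 1) i l = W j i (l - 1) * B l + W j i (l + 1) * B (l + 1)) →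
    ∑ i ∈ s, |W j i (i + d) - cW j d * B i ^ j| ≤ C := by
  induction j with
  | zero =>
    intro d
    refine ⟨0, le_rfl, ?_⟩
    intro B W s hB hV h0 hr
    apply le_of_eq
    apply Finset.sum_eq_zero
    intro i hi
    rw [h0 i hi, cW]
    simp
  | succ j ih =>
    intro d
    obtain ⟨C1, hC1, h1⟩ := ih (d - 1)
    obtain ⟨C2, hC2, h2⟩ := ih (d + 1)
    refine ⟨C1 + C2 + |cW j (d - 1)| * (d.natAbs : ℝ) + |cW j (d + 1)| * ((d + 1).natAbs : ℝ),
      by positivity, ?_⟩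
    intro B W s hB hV h0 hr
    have g1 := h1 B W s hB hV h0 hr
    have g2 := h2 B W s hB hV h0 hr
    have g3 := shift_int B hV d s
    have g4 := shift_int B hV (d + 1) s
    have key : ∀ i ∈ s, |W (j + 1) i (i + d) - cW (j + 1) d * B i ^ (j + 1)| ≤
        |W j i (i + (d - 1)) - cW j (d - 1) * B i ^ j| + |W j i (i + (d + 1)) - cW j (d + 1) * B i ^ j|
        + |cW j (d - 1)| * |B (i + d) - B i| + |cW j (d + 1)| * |B (i + (d + 1)) - B i| := by
      intro i hi
      rw [hr j i hi, cW]
      have e1 : i + d - 1 = i + (d - 1) := by ring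
      have e2 : i + d + 1 = i + (d + 1) := by ring
      rw [e1, e2]
      have e : W j i (i + (d - 1)) * B (i + d) + W j i (i + (d + 1)) * B (i + (d + 1)) -
          (cW j (d - 1) + cW j (d + 1)) * B i ^ (j + 1) =
          (W j i (i + (d - 1)) - cW j (d - 1) * B i ^ j) * B (i + d) +
          (W j i (i + (d + 1)) - cW j (d + 1) * B i ^ j) * B (i + (d + 1)) +
          cW j (d - 1) * (B (i + d) - B i) * B i ^ j +
          cW j (d + 1) * (B (i + (d + 1)) - B i) * B i ^ j := by ring
      rw [e]
      have hp : |B i ^ j| ≤ 1 := by rw [abs_pow]; exact pow_le_one₀ (abs_nonneg _) (hB i)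
      refine (abs_add_le _ _).trans (add_le_add ((abs_add_le _ _).trans (add_le_add
        ((abs_add_le _ _).trans (add_le_add ?_ ?_)) ?_)) ?_)
      · rw [abs_mul]; exact mul_le_of_le_one_right (abs_nonneg _) (hB _)
      · rw [abs_mul]; exact mul_le_of_le_one_right (abs_nonneg _) (hB _)
      · rw [← abs_mul, abs_mul (_ * (_ - _))]; exact mul_le_of_le_one_right (abs_nonneg _) hp
      · rw [← abs_mul, abs_mul (_ * (_ - _))]; exact mul_le_of_le_one_right (abs_nonneg _) hp
    refine (Finset.sum_le_sum key).trans ?_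
    simp only [Finset.sum_add_distrib, ← Finset.mul_sum]
    gcongr


/-- truncated coefficient sequence on `ℤ` -/
def Bt (β : ℕ → ℝ) (N : ℕ) (l : ℤ) : ℝ := if 0 < l ∧ l < N then β l.toNat else 0

/-- the integers `0, …, N-1` -/
def SN (N : ℕ) : Finset ℤ := (Finset.range N).map Nat.castEmbedding

lemma mem_SN (N : ℕ) (i : ℤ) : i ∈ SN N ↔ 0 ≤ i ∧ i < N := by
  simp only [SN, Finset.mem_map, Finset.mem_range, Nat.castEmbedding_apply]
  constructor
  · rintro ⟨a, ha, rfl⟩; omega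
  · intro h; exact ⟨i.toNat, by omega, by omega⟩

lemma sum_SN (N : ℕ) (f : ℤ → ℝ) : ∑ i ∈ SN N, f i = ∑ i ∈ Finset.range N, f (i : ℤ) := by
  simp [SN]

lemma Bt_tv (β : ℕ → ℝ) (N : ℕ) (h0 : ∀ l, 1 ≤ l → 0 ≤ β l) (h1 : ∀ l, 1 ≤ l → β l ≤ 1 / 2)
    (hm : ∀ l, 1 ≤ l → β l ≤ β (l + 1)) (s : Finset ℤ) :
    ∑ i ∈ s, |Bt β N (i + 1) - Bt β N i| ≤ 1 := by
  have hn : ∀ l, 0 ≤ Bt β N l := by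
    intro l; rw [Bt]; split_ifs with h
    · exact h0 _ (by omega)
    · exact le_rfl
  have hl : ∀ l, Bt β N l ≤ 1 / 2 := by
    intro l; rw [Bt]; split_ifs with h
    · exact h1 _ (by omega)
    · norm_num
  have e1 : ∑ i ∈ s, |Bt β N (i + 1) - Bt β N i| ≤ ∑ i ∈ SN N, |Bt β N (i + 1) - Bt β N i| := by
    have : ∑ i ∈ SN N, |Bt β N (i + 1) - Bt β N i| = ∑ i ∈ s ∪ SN N, |Bt β N (i + 1) - Bt β N i| := by
      apply Finset.sum_subset Finset.subset_union_right
      intro i _ hi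
      rw [mem_SN] at hi
      rw [Bt, Bt, if_neg (by omega), if_neg (by omega)]; simp
    rw [this]
    exact Finset.sum_le_sum_of_subset_of_nonneg Finset.subset_union_left
      (fun i _ _ => abs_nonneg _)
  refine e1.trans ?_
  rw [sum_SN]
  rcases N with _ | N
  · simp
  rw [Finset.sum_range_succ]
  have e2 : ∀ i ∈ Finset.range N, |Bt β (N+1) ((i:ℤ) + 1) - Bt β (N+1) i| =
      Bt β (N+1) ((i + 1 : ℕ) : ℤ) - Bt β (N+1) ((i : ℕ) : ℤ) := by
    intro i hi
    rw [Finset.mem_range] at hi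
    push_cast
    apply abs_of_nonneg
    rcases i with _ | i
    · have : Bt β (N+1) ((0:ℕ):ℤ) = 0 := by rw [Bt, if_neg (by simp)]
      rw [this]; have := hn (((0:ℕ):ℤ) + 1); linarith
    · have a1 : Bt β (N+1) (((i+1:ℕ):ℤ)) = β (i+1) := by
        rw [Bt, if_pos (by omega)]; rfl
      have a2 : Bt β (N+1) (((i+1:ℕ):ℤ) + 1) = β (i+1+1) := by
        rw [Bt, if_pos (by omega)]; rfl
      rw [a1, a2]; linarith [hm (i+1) (by omega)]
  rw [Finset.sum_congr rfl e2, Finset.sum_range_sub (fun i : ℕ => Bt β (N+1) (i : ℤ))]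
  have a3 : Bt β (N+1) ((0:ℕ):ℤ) = 0 := by rw [Bt, if_neg (by simp)]
  have a4 : Bt β (N+1) ((N:ℤ)+1) = 0 := by rw [Bt, if_neg (by push_cast; omega)]
  rw [a3, a4, zero_sub, abs_neg, abs_of_nonneg (hn _)]
  linarith [hl N]

/-- truncated polynomial sequence on `ℤ` -/
def Pz (q : ℕ → ℝ → ℝ) (N : ℕ) (l : ℤ) (x : ℝ) : ℝ := if 0 ≤ l ∧ l < N then q l.toNat x else 0

lemma Pz_nat (q : ℕ → ℝ → ℝ) (N : ℕ) (l : ℕ) (h : l < N) (x : ℝ) : Pz q N l x = q l x := by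
  rw [Pz, if_pos (by omega)]; rfl

lemma Bt_nat (β : ℕ → ℝ) (N : ℕ) (l : ℕ) (h : l + 1 < N) : Bt β N ((l : ℤ) + 1) = β (l + 1) := by
  rw [Bt, if_pos (by omega)]; rfl

lemma Pz_rec (β : ℕ → ℝ) (q : ℕ → ℝ → ℝ) (N : ℕ) (x : ℝ)
    (h1 : β 1 * q 1 x = x * q 0 x)
    (h2 : ∀ l, β (l + 2) * q (l + 2) x = x * q (l + 1) x - β (l + 1) * q l x)
    (hx : q N x = 0) (l : ℤ) :
    x * Pz q N l x = Pz q N (l - 1) x * Bt β N l + Pz q N (l + 1) x * Bt β N (l + 1) := by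
  by_cases hl : 0 ≤ l ∧ l < N
  · obtain ⟨n, rfl⟩ := Int.eq_ofNat_of_zero_le hl.1
    have hn : n < N := by omega
    have hlast : β (n + 1) * q (n + 1) x = Pz q N (n + 1) x * Bt β N (n + 1) := by
      by_cases h : n + 1 < N
      · have := Pz_nat q N (n+1) h x
        push_cast at this
        rw [this, Bt_nat β N n h, mul_comm]
      · have : n + 1 = N := by omega
        rw [this, hx]; rw [Bt, if_neg (by omega)]; simp
    rw [← hlast, Pz_nat q N n hn]
    rcases n with _ | n
    · have : Bt β N ((0:ℕ):ℤ) = 0 := by rw [Bt, if_neg (by simp)]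
      rw [this]; linarith
    · have e : (((n+1:ℕ):ℤ) - 1) = n := by push_cast; ring
      have e' : ((n+1:ℕ):ℤ) = n + 1 := by push_cast; ring
      rw [e, Pz_nat q N n (by omega), e', Bt_nat β N n hn]
      have := h2 n
      linarith
  · have a : Bt β N l = 0 := by rw [Bt, if_neg (by omega)]
    have a' : Bt β N (l + 1) = 0 := by rw [Bt, if_neg (by omega)]
    rw [a, a', Pz, if_neg hl]; simp

lemma root_bound (β : ℕ → ℝ) (q : ℕ → ℝ → ℝ) (N : ℕ) (hN : 0 < N) (x : ℝ)
    (h0 : ∀ l, 1 ≤ l → 0 ≤ β l) (hb : ∀ l, 1 ≤ l → β l ≤ 1 / 2) (hq : q 0 x ≠ 0)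
    (h1 : β 1 * q 1 x = x * q 0 x)
    (h2 : ∀ l, β (l + 2) * q (l + 2) x = x * q (l + 1) x - β (l + 1) * q l x)
    (hx : q N x = 0) : |x| ≤ 1 := by
  have hB : ∀ l, |Bt β N l| ≤ 1 / 2 := by
    intro l; rw [Bt]; split_ifs with h
    · rw [abs_of_nonneg (h0 _ (by omega))]; exact hb _ (by omega)
    · norm_num
  obtain ⟨l, hl, hmax⟩ := Finset.exists_max_image (SN N) (fun l => |Pz q N l x|)
    ⟨0, by rw [mem_SN]; omega⟩
  have hmax' : ∀ l', |Pz q N l' x| ≤ |Pz q N l x| := by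
    intro l'
    by_cases h : l' ∈ SN N
    · exact hmax l' h
    · rw [mem_SN] at h
      have : Pz q N l' x = 0 := by rw [Pz, if_neg h]
      rw [this]; simp
  have hpos : 0 < |Pz q N l x| := by
    refine lt_of_lt_of_le ?_ (hmax' ((0:ℕ):ℤ))
    rw [Pz_nat q N 0 hN]; exact abs_pos.mpr hq
  have hr := Pz_rec β q N x h1 h2 hx l
  have : |x| * |Pz q N l x| ≤ 1 * |Pz q N l x| := by
    rw [← abs_mul, hr]
    refine (abs_add_le _ _).trans ?_
    rw [abs_mul, abs_mul]
    have t1 := mul_le_mul (hmax' (l - 1)) (hB l) (abs_nonneg _) (abs_nonneg _)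
    have t2 := mul_le_mul (hmax' (l + 1)) (hB (l + 1)) (abs_nonneg _) (abs_nonneg _)
    linarith
  exact le_of_mul_le_mul_right this hpos

lemma exists_W (β : ℕ → ℝ) (q : ℕ → ℝ → ℝ) (N : ℕ) (xs : Fin N → ℝ) (hinj : Function.Injective xs)
    (q0 : ℝ) (hq0 : q0 ≠ 0) (hq : ∀ x, q 0 x = q0)
    (h1 : ∀ x, β 1 * q 1 x = x * q 0 x)
    (h2 : ∀ l x, β (l + 2) * q (l + 2) x = x * q (l + 1) x - β (l + 1) * q l x)
    (hx : ∀ r, q N (xs r) = 0) :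
    ∃ W : ℕ → ℤ → ℤ → ℝ, (∀ i ∈ SN N, ∀ l, W 0 i l = if i = l then 1 else 0) ∧
    (∀ j, ∀ i ∈ SN N, ∀ l, W (j + 1) i l =
      W j i (l - 1) * Bt β N l + W j i (l + 1) * Bt β N (l + 1)) ∧
    ∀ j, ∑ i ∈ SN N, W j i i = ∑ r, xs r ^ j := by
  let P : Matrix (Fin N) (Fin N) ℝ := fun l r => q l (xs r)
  have hdet : P.det ≠ 0 := by
    intro hd
    obtain ⟨g, hg, hg0⟩ := Matrix.exists_mulVec_eq_zero_iff.mpr hd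
    apply hg
    have hz : ∀ l < N, ∑ r, xs r ^ 0 * q l (xs r) * g r = 0 := by
      intro l hl
      have := congrFun hg0 ⟨l, hl⟩
      simpa [Matrix.mulVec, dotProduct, P] using this
    have hall : ∀ t l, l + t < N → ∑ r, xs r ^ t * q l (xs r) * g r = 0 := by
      intro t
      induction t with
      | zero => intro l hl; exact hz l (by omega)
      | succ t ih =>
        intro l hl
        rcases l with _ | l
        · have := ih 1 (by omega)
          have e : ∑ r, xs r ^ (t + 1) * q 0 (xs r) * g r =
              β 1 * ∑ r, xs r ^ t * q 1 (xs r) * g r := by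
            rw [Finset.mul_sum]; apply Finset.sum_congr rfl; intro r _
            linear_combination (-xs r ^ t * g r) * h1 (xs r)
          rw [e, this, mul_zero]
        · have a1 := ih (l + 2) (by omega)
          have a2 := ih l (by omega)
          have e : ∑ r, xs r ^ (t + 1) * q (l + 1) (xs r) * g r =
              β (l + 2) * ∑ r, xs r ^ t * q (l + 2) (xs r) * g r +
              β (l + 1) * ∑ r, xs r ^ t * q l (xs r) * g r := by
            rw [Finset.mul_sum, Finset.mul_sum, ← Finset.sum_add_distrib]
            apply Finset.sum_congr rfl; intro r _
            linear_combination (-xs r ^ t * g r) * h2 l (xs r)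
          rw [e, a1, a2]; ring
    apply Matrix.eq_zero_of_forall_pow_sum_mul_pow_eq_zero hinj
    intro t
    have := hall t 0 (by omega)
    simp only [hq] at this
    have e : ∑ r, xs r ^ (t:ℕ) * q0 * g r = q0 * ∑ r, g r * xs r ^ (t:ℕ) := by
      rw [Finset.mul_sum]; apply Finset.sum_congr rfl; intro r _; ring
    rw [e] at this
    exact (mul_eq_zero.mp this).resolve_left hq0
  have hu : IsUnit P.det := isUnit_iff_ne_zero.mpr hdet
  let Q : Fin N → ℤ → ℝ := fun r i => if h : i.toNat < N then P⁻¹ r ⟨i.toNat, h⟩ else 0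
  refine ⟨fun j i l => ∑ r, Q r i * xs r ^ j * Pz q N l (xs r), ?_, ?_, ?_⟩
  · intro i hi l
    rw [mem_SN] at hi
    by_cases hl : 0 ≤ l ∧ l < N
    · obtain ⟨n, rfl⟩ := Int.eq_ofNat_of_zero_le hl.1
      obtain ⟨i, rfl⟩ := Int.eq_ofNat_of_zero_le hi.1
      have hn : n < N := by omega
      have hi' : i < N := by omega
      have := congrFun (congrFun (Matrix.mul_nonsing_inv P hu) ⟨n, hn⟩) ⟨i, hi'⟩
      rw [Matrix.mul_apply, Matrix.one_apply] at this
      simp only [Fin.mk.injEq] at this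
      simp only [Nat.cast_inj]
      have e : (if i = n then (1:ℝ) else 0) = if n = i then 1 else 0 := by simp [eq_comm]
      rw [e, ← this]
      apply Finset.sum_congr rfl; intro r _
      rw [Pz_nat q N n hn]
      simp [Q, P, hi', mul_comm]
    · rw [if_neg (by rintro rfl; exact hl hi)]
      apply Finset.sum_eq_zero; intro r _
      rw [Pz, if_neg hl, mul_zero]
  · intro j i _ l
    rw [Finset.sum_mul, Finset.sum_mul, ← Finset.sum_add_distrib]
    apply Finset.sum_congr rfl; intro r _
    have := Pz_rec β q N (xs r) (h1 _) (fun l => h2 l _) (hx r) l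
    linear_combination (Q r i * xs r ^ j) * this
  · intro j
    rw [sum_SN, Finset.sum_comm]
    apply Finset.sum_congr rfl; intro r _
    have := congrFun (congrFun (Matrix.nonsing_inv_mul P hu) r) r
    rw [Matrix.mul_apply, Matrix.one_apply_eq] at this
    rw [Finset.sum_range]
    calc _ = ∑ i : Fin N, xs r ^ j * (P⁻¹ r i * P i r) := by
          apply Finset.sum_congr rfl; intro i _
          rw [Pz_nat q N i i.2]
          simp [Q, P]; ring
      _ = _ := by rw [← Finset.mul_sum, this, mul_one]

lemma moment_bound (j : ℕ) : ∃ C : ℝ, 0 ≤ C ∧ ∀ (β : ℕ → ℝ) (q : ℕ → ℝ → ℝ) (N : ℕ) (xs : Fin N → ℝ)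
    (_ : Function.Injective xs)
    (q0 : ℝ) (_ : q0 ≠ 0) (_ : ∀ x, q 0 x = q0)
    (_ : ∀ x, β 1 * q 1 x = x * q 0 x)
    (_ : ∀ l x, β (l + 2) * q (l + 2) x = x * q (l + 1) x - β (l + 1) * q l x)
    (_ : ∀ r, q N (xs r) = 0)
    (_ : ∀ l, 1 ≤ l → 0 ≤ β l) (_ : ∀ l, 1 ≤ l → β l ≤ 1 / 2)
    (_ : ∀ l, 1 ≤ l → β l ≤ β (l + 1)),
    |∑ r, xs r ^ j - cW j 0 * ∑ i ∈ Finset.range N, Bt β N i ^ j| ≤ C := by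
  obtain ⟨C, hC, h⟩ := walk_bound j 0
  refine ⟨C, hC, ?_⟩
  intro β q N xs hinj q0 hq0 hq h1 h2 hx g0 g1 g2
  obtain ⟨W, w0, w1, w2⟩ := exists_W β q N xs hinj q0 hq0 hq h1 h2 hx
  have hB : ∀ l, |Bt β N l| ≤ 1 := by
    intro l; rw [Bt]; split_ifs with h
    · rw [abs_of_nonneg (g0 _ (by omega))]; linarith [g1 l.toNat (by omega)]
    · norm_num
  have := h (Bt β N) W (SN N) hB (Bt_tv β N g0 g1 g2) w0 w1
  rw [← w2, ← sum_SN N (fun i => Bt β N i ^ j), Finset.mul_sum, ← Finset.sum_sub_distrib]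
  refine (Finset.abs_sum_le_sum_abs _ _).trans ?_
  simpa using this


/-- squared coefficient -/
def gam (k L : ℕ) : ℝ := ((L : ℝ) ^ 2 - (k : ℝ) ^ 2) / (4 * (L : ℝ) ^ 2 - 1)

lemma b_succ_eq (k l : ℕ) : b (k : ℝ) (l + 1) = Real.sqrt (gam k (k + (l + 1))) := by
  rw [b, gam]; congr 1; push_cast; congr 1 <;> ring

lemma gam_nonneg (k L : ℕ) (hk : 1 ≤ k) (h : k ≤ L) : 0 ≤ gam k L := by
  have h1 : (1:ℝ) ≤ k := by exact_mod_cast hk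
  have h2 : (k:ℝ) ≤ L := by exact_mod_cast h
  apply div_nonneg <;> nlinarith

lemma gam_le (k L : ℕ) (hk : 1 ≤ k) (h : k ≤ L) : gam k L ≤ 1 / 4 := by
  have h1 : (1:ℝ) ≤ k := by exact_mod_cast hk
  have h2 : (k:ℝ) ≤ L := by exact_mod_cast h
  rw [gam, div_le_iff₀ (by nlinarith)]; nlinarith

lemma gam_mono (k L : ℕ) (hk : 1 ≤ k) (h : k ≤ L) : gam k L ≤ gam k (L + 1) := by
  have h1 : (1:ℝ) ≤ k := by exact_mod_cast hk
  have h2 : (k:ℝ) ≤ L := by exact_mod_cast h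
  rw [gam, gam]
  push_cast
  rw [div_le_div_iff₀ (by nlinarith) (by nlinarith)]
  have : 0 ≤ (4 * (k:ℝ)^2 - 1) * (2 * L + 1) := by apply mul_nonneg <;> nlinarith
  nlinarith

lemma b_pos (k : ℕ) (hk : 1 ≤ k) (l : ℕ) : 0 < b (k : ℝ) l := by
  have h1 : (1:ℝ) ≤ k := by exact_mod_cast hk
  rcases l with _ | l
  · rw [b]
    apply Real.sqrt_pos.mpr
    have := Real.Gamma_pos_of_pos (s := (k:ℝ) + 1) (by linarith)
    have := Real.Gamma_pos_of_pos (s := (k:ℝ) + 3 / 2) (by linarith)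
    have := Real.pi_pos
    positivity
  · rw [b_succ_eq]
    apply Real.sqrt_pos.mpr
    rw [gam]; push_cast
    have h2 : (0:ℝ) ≤ l := Nat.cast_nonneg l
    apply div_pos <;> nlinarith

lemma b_le (k : ℕ) (hk : 1 ≤ k) (l : ℕ) (hl : 1 ≤ l) : b (k : ℝ) l ≤ 1 / 2 := by
  obtain ⟨l, rfl⟩ := Nat.exists_eq_add_of_le' hl
  rw [b_succ_eq]
  apply Real.sqrt_le_iff.mpr
  refine ⟨by norm_num, ?_⟩
  have := gam_le k (k + (l + 1)) hk (by omega)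
  linarith

lemma b_mono (k : ℕ) (hk : 1 ≤ k) (l : ℕ) (hl : 1 ≤ l) : b (k : ℝ) l ≤ b (k : ℝ) (l + 1) := by
  obtain ⟨l, rfl⟩ := Nat.exists_eq_add_of_le' hl
  rw [b_succ_eq, b_succ_eq]
  exact Real.sqrt_le_sqrt (gam_mono k (k + (l + 1)) hk (by omega))

lemma pA_one (k : ℕ) (hk : 1 ≤ k) (x : ℝ) :
    b (k : ℝ) 1 * pA k 0 1 x = x * pA k 0 0 x := by
  have := b_pos k hk 1
  rw [pA, pA]
  field_simp

lemma pA_two (k : ℕ) (hk : 1 ≤ k) (l : ℕ) (x : ℝ) :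
    b (k : ℝ) (l + 2) * pA k 0 (l + 2) x = x * pA k 0 (l + 1) x - b k (l + 1) * pA k 0 l x := by
  have := b_pos k hk (l + 2)
  rw [pA]
  simp only [zero_add]
  field_simp

lemma pA_root_le (k N : ℕ) (hk : 1 ≤ k) (hN : 0 < N) (x : ℝ) (hx : pA k 0 N x = 0) : |x| ≤ 1 := by
  refine root_bound (b k) (pA k 0) N hN x (fun l _ => (b_pos k hk l).le) (b_le k hk) ?_
    (pA_one k hk x) (fun l => pA_two k hk l x) hx
  rw [pA]; have := b_pos k hk 0; positivity

lemma Bt_pow (k N i s : ℕ) (hk : 1 ≤ k) (hi : i < N) :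
    Bt (b k) N i ^ (2 * s) = gam k (k + i) ^ s := by
  rw [pow_mul]
  congr 1
  rcases i with _ | i
  · rw [Bt, if_neg (by simp), gam]; simp
  · push_cast
    rw [Bt_nat _ _ _ hi, b_succ_eq, Real.sq_sqrt (gam_nonneg _ _ hk (by omega))]

lemma per_k (s : ℕ) : ∃ C : ℝ, 0 ≤ C ∧ ∀ (k N : ℕ) (x : ℕ → ℝ), 1 ≤ k →
    (∀ i < N, pA k 0 N (x i) = 0) → (∀ i < N, ∀ i' < N, x i = x i' → i = i') →
    |∑ i ∈ Finset.range N, x i ^ (2 * s) -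
      (s.centralBinom : ℝ) * ∑ i ∈ Finset.range N, gam k (k + i) ^ s| ≤ C := by
  obtain ⟨C, hC, h⟩ := moment_bound (2 * s)
  refine ⟨C, hC, ?_⟩
  intro k N x hk hx hinj
  have := h (b k) (pA k 0) N (fun r => x r)
    (fun r r' e => Fin.ext (hinj r r.2 r' r'.2 e)) (1 / b k 0)
    (by have := b_pos k hk 0; positivity) (fun x => by rw [pA])
    (pA_one k hk) (pA_two k hk) (fun r => hx r r.2) (fun l _ => (b_pos k hk l).le)
    (b_le k hk) (b_mono k hk)
  rw [cW_even, ← Finset.sum_range (fun r => x r ^ (2 * s))] at this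
  rwa [Finset.sum_congr rfl (fun i hi => Bt_pow k N i s hk (Finset.mem_range.mp hi))] at this

lemma per_k_odd (j : ℕ) (hj : j % 2 = 1) : ∃ C : ℝ, 0 ≤ C ∧ ∀ (k N : ℕ) (x : ℕ → ℝ), 1 ≤ k →
    (∀ i < N, pA k 0 N (x i) = 0) → (∀ i < N, ∀ i' < N, x i = x i' → i = i') →
    |∑ i ∈ Finset.range N, x i ^ j| ≤ C := by
  obtain ⟨C, hC, h⟩ := moment_bound j
  refine ⟨C, hC, ?_⟩
  intro k N x hk hx hinj
  have := h (b k) (pA k 0) N (fun r => x r)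
    (fun r r' e => Fin.ext (hinj r r.2 r' r'.2 e)) (1 / b k 0)
    (by have := b_pos k hk 0; positivity) (fun x => by rw [pA])
    (pA_one k hk) (pA_two k hk) (fun r => hx r r.2) (fun l _ => (b_pos k hk l).le)
    (b_le k hk) (b_mono k hk)
  rw [cW_odd j 0 (by omega), ← Finset.sum_range (fun r => x r ^ j)] at this
  simpa using this

lemma I_s (s : ℕ) : (s.centralBinom : ℝ) * ∫ t in (0:ℝ)..1, (1 - t ^ 2) ^ s = 4 ^ s / (2 * s + 1) := by
  induction s with
  | zero => simp
  | succ s ih =>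
    have hd : ∀ t ∈ Set.uIcc (0:ℝ) 1, HasDerivAt (fun t : ℝ => t * (1 - t ^ 2) ^ (s + 1))
        ((2 * s + 3) * (1 - t ^ 2) ^ (s + 1) - (2 * s + 2) * (1 - t ^ 2) ^ s) t := by
      intro t _
      have h1 : HasDerivAt (fun t : ℝ => 1 - t ^ 2) (-(2 * t)) t := by
        simpa using (hasDerivAt_pow 2 t).const_sub 1
      have h2 : HasDerivAt (fun t : ℝ => t * (1 - t ^ 2) ^ (s + 1))
          (1 * (1 - t ^ 2) ^ (s + 1) + t * (((s + 1 : ℕ) : ℝ) * (1 - t ^ 2) ^ s * -(2 * t))) t :=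
        (hasDerivAt_id t).mul (h1.pow (s + 1))
      refine h2.congr_deriv ?_
      push_cast
      ring
    have hi := intervalIntegral.integral_eq_sub_of_hasDerivAt hd
      (by apply Continuous.intervalIntegrable; fun_prop)
    rw [intervalIntegral.integral_sub (by apply Continuous.intervalIntegrable; fun_prop)
      (by apply Continuous.intervalIntegrable; fun_prop),
      intervalIntegral.integral_const_mul, intervalIntegral.integral_const_mul] at hi
    simp only [one_pow, sub_self, ne_eq, Nat.add_eq_zero_iff, one_ne_zero, and_false,
      not_false_eq_true, zero_pow, mul_zero, zero_mul] at hi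
    have hc : ((s:ℝ) + 1) * ((s + 1).centralBinom : ℝ) = 2 * (2 * s + 1) * (s.centralBinom : ℝ) := by
      exact_mod_cast Nat.succ_mul_centralBinom_succ s
    set A := ∫ t in (0:ℝ)..1, (1 - t ^ 2) ^ s
    set A' := ∫ t in (0:ℝ)..1, (1 - t ^ 2) ^ (s + 1)
    rw [eq_div_iff (by positivity)] at ih ⊢
    have hs : (s:ℝ) + 1 ≠ 0 := by positivity
    apply mul_left_cancel₀ hs
    push_cast
    rw [pow_succ]
    linear_combination (A' * (2 * s + 3)) * hc + (2 * (2 * s + 1) * (s.centralBinom : ℝ)) * hi +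
      4 * (s + 1) * ih

lemma pow_diff (u v : ℝ) (hu : 0 ≤ u) (hu1 : u ≤ 1) (hv : 0 ≤ v) (hv1 : v ≤ 1) (s : ℕ) :
    |u ^ s - v ^ s| ≤ s * |u - v| := by
  induction s with
  | zero => simp
  | succ s ih =>
    have e : u ^ (s + 1) - v ^ (s + 1) = (u ^ s - v ^ s) * u + v ^ s * (u - v) := by ring
    rw [e]
    refine (abs_add_le _ _).trans ?_
    rw [abs_mul, abs_mul, abs_of_nonneg hu, abs_of_nonneg (pow_nonneg hv s)]
    have h1 := mul_le_of_le_one_right (abs_nonneg (u ^ s - v ^ s)) hu1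
    have h2 := mul_le_of_le_one_left (abs_nonneg (u - v)) (pow_le_one₀ hv hv1 (n := s))
    push_cast
    linarith

lemma riemann (s L : ℕ) (hL : 1 ≤ L) :
    |∑ k ∈ Finset.range L, (1 - (((k + 1 : ℕ) : ℝ) / L) ^ 2) ^ s - (L:ℝ) * ∫ t in (0:ℝ)..1, (1 - t ^ 2) ^ s| ≤ 1 := by
  have hL' : (0:ℝ) < L := by exact_mod_cast hL
  have hanti : AntitoneOn (fun t : ℝ => (1 - (t / L) ^ 2) ^ s) (Set.Icc 0 (0 + (L:ℝ))) := by
    intro x hx y hy hxy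
    simp only [zero_add, Set.mem_Icc] at hx hy
    have h1 : x / L ≤ y / L := by gcongr
    have h2 : 0 ≤ x / L := div_nonneg hx.1 hL'.le
    have h3 : y / L ≤ 1 := by rw [div_le_one hL']; exact hy.2
    apply pow_le_pow_left₀ <;> nlinarith
  have a1 := hanti.sum_le_integral
  have a2 := hanti.integral_le_sum
  have e : ∫ t in (0:ℝ)..(0 + L), (1 - (t / L) ^ 2) ^ s = (L:ℝ) * ∫ t in (0:ℝ)..1, (1 - t ^ 2) ^ s := by
    rw [intervalIntegral.integral_comp_div (fun t => (1 - t ^ 2) ^ s) hL'.ne']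
    simp [hL'.ne']
  rw [e] at a1 a2
  simp only [zero_add] at a1 a2
  have e3 := Finset.sum_range_succ' (fun k : ℕ => (1 - ((k : ℝ) / L) ^ 2) ^ s) L
  rw [Finset.sum_range_succ] at e3
  have z1 : (1 - ((L:ℝ) / L) ^ 2) ^ s ≥ 0 := by rw [div_self hL'.ne']; simp
  simp only [Nat.cast_zero, zero_div] at e3
  norm_num at e3
  push_cast at a1 a2 ⊢
  rw [abs_le]; constructor <;> linarith

lemma per_L (s L : ℕ) (hL : 1 ≤ L) :
    |∑ k ∈ Finset.range L, gam (k + 1) L ^ s -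
      ((L:ℝ) * ∫ t in (0:ℝ)..1, (1 - t ^ 2) ^ s) / 4 ^ s| ≤ (s:ℝ) + 1 := by
  have hL' : (1:ℝ) ≤ L := by exact_mod_cast hL
  have h1 : ∀ k ∈ Finset.range L, |gam (k + 1) L ^ s - (1 - (((k + 1 : ℕ) : ℝ) / L) ^ 2) ^ s / 4 ^ s|
      ≤ (s:ℝ) * (1 / (L:ℝ)) := by
    intro k hk
    have hk' : k + 1 ≤ L := by rw [Finset.mem_range] at hk; omega
    have hkL : ((k + 1 : ℕ) : ℝ) ≤ L := by exact_mod_cast hk'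
    have hk0 : (1:ℝ) ≤ ((k + 1 : ℕ) : ℝ) := by push_cast; linarith [(Nat.cast_nonneg k : (0:ℝ) ≤ k)]
    have hd : (0:ℝ) < 4 * (L:ℝ)^2 - 1 := by nlinarith
    rw [← div_pow]
    set K := ((k + 1 : ℕ) : ℝ) with hK
    have q0 : 0 ≤ K / L := by positivity
    have q1 : K / L ≤ 1 := by rw [div_le_one (by linarith)]; exact hkL
    have v0 : 0 ≤ (1 - (K / L) ^ 2) / 4 := by apply div_nonneg _ (by norm_num); nlinarith
    have v1 : (1 - (K / L) ^ 2) / 4 ≤ 1 := by nlinarith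
    refine (pow_diff _ _ (gam_nonneg _ _ (by omega) hk') ((gam_le _ _ (by omega) hk').trans (by norm_num))
      v0 v1 s).trans ?_
    apply mul_le_mul_of_nonneg_left _ (Nat.cast_nonneg s)
    have e : gam (k + 1) L - (1 - (K / L) ^ 2) / 4 = ((1 - (K / L) ^ 2) / 4) * (1 / (4 * (L:ℝ)^2 - 1)) := by
      have hd' : 4 * (L:ℝ)^2 - 1 ≠ 0 := hd.ne'
      have hL0 : (L:ℝ) ≠ 0 := by linarith
      rw [gam, ← hK, div_pow, one_sub_div (by positivity), div_div, div_mul_div_comm, div_sub_div _ _ hd' (by positivity),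
        div_eq_div_iff (by positivity) (by positivity)]; ring
    rw [e, abs_of_nonneg (mul_nonneg v0 (by positivity))]
    calc _ ≤ 1 * (1 / (4 * (L:ℝ)^2 - 1)) := by
          apply mul_le_mul_of_nonneg_right v1 (by positivity)
      _ ≤ 1 / L := by
          rw [one_mul]; apply one_div_le_one_div_of_le (by linarith); nlinarith
  have h2 : |∑ k ∈ Finset.range L, gam (k + 1) L ^ s -
      (∑ k ∈ Finset.range L, (1 - (((k + 1 : ℕ) : ℝ) / L) ^ 2) ^ s) / 4 ^ s| ≤ (s:ℝ) := by
    rw [Finset.sum_div, ← Finset.sum_sub_distrib]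
    refine (Finset.abs_sum_le_sum_abs _ _).trans ((Finset.sum_le_sum h1).trans ?_)
    simp only [Finset.sum_const, Finset.card_range, nsmul_eq_mul]
    apply le_of_eq; field_simp
  have h3 := riemann s L hL
  have h4 : |(∑ k ∈ Finset.range L, (1 - (((k + 1 : ℕ) : ℝ) / L) ^ 2) ^ s) / 4 ^ s -
      ((L:ℝ) * ∫ t in (0:ℝ)..1, (1 - t ^ 2) ^ s) / 4 ^ s| ≤ 1 := by
    rw [← sub_div, abs_div, abs_of_pos (by positivity : (0:ℝ) < 4 ^ s)]
    rw [div_le_one (by positivity)]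
    exact h3.trans (one_le_pow₀ (by norm_num))
  exact (abs_sub_le _ _ _).trans (add_le_add h2 h4)

lemma per_L' (s m : ℕ) : ∃ C : ℝ, 0 ≤ C ∧ ∀ L : ℕ, m + 1 ≤ L →
    |(s.centralBinom : ℝ) * ∑ k ∈ Finset.Ico (m + 1) (L + 1), gam k L ^ s - L / (2 * s + 1)| ≤ C := by
  refine ⟨(s.centralBinom : ℝ) * (m + (s + 1)), by positivity, ?_⟩
  intro L hL
  have h1 := per_L s L (by omega)
  have hI := I_s s
  set A := ∫ t in (0:ℝ)..1, (1 - t ^ 2) ^ s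
  have e1 : ∑ k ∈ Finset.range L, gam (k + 1) L ^ s = ∑ k ∈ Finset.Ico 1 (L + 1), gam k L ^ s := by
    rw [Finset.sum_Ico_eq_sum_range]
    simp [add_comm]
  rw [e1, ← Finset.sum_Ico_consecutive _ (by omega : 1 ≤ m + 1) (by omega : m + 1 ≤ L + 1)] at h1
  have h2 : |∑ k ∈ Finset.Ico 1 (m + 1), gam k L ^ s| ≤ m := by
    refine (Finset.abs_sum_le_sum_abs _ _).trans ?_
    have : ∀ k ∈ Finset.Ico 1 (m + 1), |gam k L ^ s| ≤ 1 := by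
      intro k hk
      rw [Finset.mem_Ico] at hk
      have g0 := gam_nonneg k L hk.1 (by omega)
      have g1 := gam_le k L hk.1 (by omega)
      rw [abs_of_nonneg (by positivity)]
      exact pow_le_one₀ g0 (by linarith)
    refine (Finset.sum_le_sum this).trans ?_
    simp
  have e2 : (L : ℝ) / (2 * s + 1) = (s.centralBinom : ℝ) * ((L * A) / 4 ^ s) := by
    have : (s.centralBinom : ℝ) * ((L * A) / 4 ^ s) = L * ((s.centralBinom : ℝ) * A) / 4 ^ s := by ring
    rw [this, hI]; field_simp
  rw [e2, ← mul_sub, abs_mul, abs_of_nonneg (Nat.cast_nonneg _)]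
  apply mul_le_mul_of_nonneg_left _ (Nat.cast_nonneg _)
  rw [abs_le] at *
  constructor <;> linarith [h1.1, h1.2, h2.1, h2.2]

lemma sum_L (m n : ℕ) (h : m ≤ n) :
    |∑ L ∈ Finset.Ico (m + 1) (n + 1), (L : ℝ) - ((n:ℝ) + 1) ^ 2 / 2| ≤ ((m:ℝ) + 1) ^ 2 * ((n:ℝ) + 1) := by
  have hr : ∀ n : ℕ, ∑ L ∈ Finset.range (n + 1), (L : ℝ) = n * (n + 1) / 2 := by
    intro n; induction n with
    | zero => simp
    | succ n ih => rw [Finset.sum_range_succ, ih]; push_cast; ring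
  rw [Finset.sum_Ico_eq_sub _ (by omega), hr, hr]
  have : (0:ℝ) ≤ m := Nat.cast_nonneg m
  have : (m:ℝ) ≤ n := by exact_mod_cast h
  have h0 : (1:ℝ) ≤ (m + 1)^2 := by nlinarith
  have h3 : ((m:ℝ) + 1)^2 * 1 ≤ (m + 1)^2 * (n + 1) := by
    apply mul_le_mul_of_nonneg_left <;> nlinarith
  have h4 : 1 * ((n:ℝ) + 1) ≤ (m + 1)^2 * (n + 1) := by
    apply mul_le_mul_of_nonneg_right <;> nlinarith
  rw [abs_le]; constructor <;> nlinarith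

/-- sum of a test function over the eigenvalues with `m < k ≤ n` -/
def Lam (m : ℕ) (x : ℕ → ℕ → ℕ → ℝ) (f : ℝ → ℝ) (n : ℕ) : ℝ :=
  ∑ k ∈ Finset.Ico (m + 1) (n + 1), ∑ i ∈ Finset.range (n + 1 - k), f (x n k i)

/-- the standing hypotheses on the roots -/
def Good (m : ℕ) (x : ℕ → ℕ → ℕ → ℝ) : Prop :=
  ∀ n k, m + 1 ≤ k → k < n + 1 → (∀ i < n + 1 - k, pA k 0 (n + 1 - k) (x n k i) = 0) ∧
    (∀ i < n + 1 - k, ∀ i' < n + 1 - k, x n k i = x n k i' → i = i')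

lemma Lam_even (m s : ℕ) (x : ℕ → ℕ → ℕ → ℝ) (hx : Good m x) :
    ∃ C : ℝ, ∀ n : ℕ, m ≤ n →
      |Lam m x (fun t => t ^ (2 * s)) n - ((n:ℝ) + 1) ^ 2 / 2 / (2 * s + 1)| ≤ C * (n + 1) := by
  obtain ⟨C1, hC1, h1⟩ := per_k s
  obtain ⟨C2, hC2, h2⟩ := per_L' s m
  refine ⟨C1 + C2 + (m + 1) ^ 2, ?_⟩
  intro n hn
  have hcard : ((Finset.Ico (m + 1) (n + 1)).card : ℝ) ≤ n + 1 := by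
    rw [Nat.card_Ico]; exact_mod_cast Nat.sub_le _ _
  have s1 : |Lam m x (fun t => t ^ (2 * s)) n - ∑ k ∈ Finset.Ico (m + 1) (n + 1),
      (s.centralBinom : ℝ) * ∑ i ∈ Finset.range (n + 1 - k), gam k (k + i) ^ s| ≤ C1 * (n + 1) := by
    rw [Lam, ← Finset.sum_sub_distrib]
    refine (Finset.abs_sum_le_sum_abs _ _).trans ?_
    refine (Finset.sum_le_card_nsmul _ _ C1 ?_).trans ?_
    · intro k hk
      rw [Finset.mem_Ico] at hk
      obtain ⟨g1, g2⟩ := hx n k hk.1 hk.2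
      exact h1 k _ (x n k) (by omega) g1 g2
    · rw [nsmul_eq_mul, mul_comm]; gcongr
  have s2 : ∑ k ∈ Finset.Ico (m + 1) (n + 1),
      (s.centralBinom : ℝ) * ∑ i ∈ Finset.range (n + 1 - k), gam k (k + i) ^ s =
      ∑ L ∈ Finset.Ico (m + 1) (n + 1),
        (s.centralBinom : ℝ) * ∑ k ∈ Finset.Ico (m + 1) (L + 1), gam k L ^ s := by
    rw [← Finset.mul_sum, ← Finset.mul_sum, ← Finset.sum_Ico_Ico_comm]
    congr 1
    apply Finset.sum_congr rfl; intro k _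
    rw [Finset.sum_Ico_eq_sum_range]
  have s3 : |∑ L ∈ Finset.Ico (m + 1) (n + 1),
        (s.centralBinom : ℝ) * ∑ k ∈ Finset.Ico (m + 1) (L + 1), gam k L ^ s -
        (∑ L ∈ Finset.Ico (m + 1) (n + 1), (L:ℝ)) / (2 * s + 1)| ≤ C2 * (n + 1) := by
    rw [Finset.sum_div, ← Finset.sum_sub_distrib]
    refine (Finset.abs_sum_le_sum_abs _ _).trans ?_
    refine (Finset.sum_le_card_nsmul _ _ C2 ?_).trans ?_
    · intro L hL
      rw [Finset.mem_Ico] at hL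
      exact h2 L hL.1
    · rw [nsmul_eq_mul, mul_comm]; gcongr
  have s4 : |(∑ L ∈ Finset.Ico (m + 1) (n + 1), (L:ℝ)) / (2 * s + 1) - ((n:ℝ) + 1) ^ 2 / 2 / (2 * s + 1)|
      ≤ ((m:ℝ) + 1) ^ 2 * ((n:ℝ) + 1) := by
    rw [← sub_div, abs_div, abs_of_pos (by positivity : (0:ℝ) < 2 * s + 1)]
    refine (div_le_self (abs_nonneg _) ?_).trans (sum_L m n hn)
    have : (0:ℝ) ≤ s := Nat.cast_nonneg s
    linarith
  rw [s2] at s1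
  have := (abs_sub_le _ _ _).trans (add_le_add ((abs_sub_le _ _ _).trans (add_le_add s1 s3)) s4)
  linarith

lemma Lam_odd (m j : ℕ) (hj : j % 2 = 1) (x : ℕ → ℕ → ℕ → ℝ) (hx : Good m x) :
    ∃ C : ℝ, ∀ n : ℕ, m ≤ n → |Lam m x (fun t => t ^ j) n| ≤ C * (n + 1) := by
  obtain ⟨C1, hC1, h1⟩ := per_k_odd j hj
  refine ⟨C1, ?_⟩
  intro n hn
  have hcard : ((Finset.Ico (m + 1) (n + 1)).card : ℝ) ≤ n + 1 := by
    rw [Nat.card_Ico]; exact_mod_cast Nat.sub_le _ _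
  rw [Lam]
  refine (Finset.abs_sum_le_sum_abs _ _).trans ?_
  refine (Finset.sum_le_card_nsmul _ _ C1 ?_).trans ?_
  · intro k hk
    rw [Finset.mem_Ico] at hk
    obtain ⟨g1, g2⟩ := hx n k hk.1 hk.2
    exact h1 k _ (x n k) (by omega) g1 g2
  · rw [nsmul_eq_mul, mul_comm]; gcongr


open Filter Topology in
lemma tendsto_helper (u : ℕ → ℝ) (l C : ℝ) (m : ℕ)
    (h : ∀ n : ℕ, m ≤ n → |u n - ((n:ℝ) + 1) ^ 2 * l| ≤ C * ((n:ℝ) + 1)) :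
    Tendsto (fun n : ℕ => u n / ((n:ℝ) + 1) ^ 2) atTop (𝓝 l) := by
  have h0 : Tendsto (fun n : ℕ => C * (1 / ((n:ℝ) + 1))) atTop (𝓝 0) := by
    simpa using tendsto_one_div_add_atTop_nhds_zero_nat.const_mul C
  rw [tendsto_iff_dist_tendsto_zero]
  refine squeeze_zero' (Eventually.of_forall fun n => dist_nonneg) ?_ h0
  filter_upwards [eventually_ge_atTop m] with n hn
  have hp : (0:ℝ) < (n:ℝ) + 1 := by positivity
  have e : u n / ((n:ℝ) + 1) ^ 2 - l = (u n - ((n:ℝ) + 1) ^ 2 * l) / ((n:ℝ) + 1) ^ 2 := by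
    field_simp
  rw [Real.dist_eq, e, abs_div, abs_of_pos (by positivity : (0:ℝ) < ((n:ℝ) + 1) ^ 2),
    div_le_iff₀ (by positivity)]
  refine (h n hn).trans (le_of_eq ?_)
  field_simp

/-- convergence of the averaged test function -/
def Conv (m : ℕ) (x : ℕ → ℕ → ℕ → ℝ) (f : ℝ → ℝ) : Prop :=
  Filter.Tendsto (fun n : ℕ => Lam m x f n / ((n:ℝ) + 1) ^ 2) Filter.atTop
    (nhds ((∫ t in (-1:ℝ)..1, f t) / 4))

lemma Conv_pow (m : ℕ) (x : ℕ → ℕ → ℕ → ℝ) (hx : Good m x) (j : ℕ) :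
    Conv m x (fun t => t ^ j) := by
  rcases Nat.even_or_odd' j with ⟨s, rfl | rfl⟩
  · obtain ⟨C, hC⟩ := Lam_even m s x hx
    refine tendsto_helper _ _ C m ?_
    intro n hn
    convert hC n hn using 3
    rw [integral_pow, pow_succ (-1 : ℝ), pow_mul]
    push_cast
    norm_num
    field_simp
    norm_num
  · obtain ⟨C, hC⟩ := Lam_odd m (2 * s + 1) (by omega) x hx
    refine tendsto_helper _ _ C m ?_
    intro n hn
    convert hC n hn using 2
    rw [integral_pow, pow_succ (-1 : ℝ), pow_succ (-1 : ℝ), pow_mul]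
    simp

lemma Lam_add (m : ℕ) (x : ℕ → ℕ → ℕ → ℝ) (f g : ℝ → ℝ) (n : ℕ) :
    Lam m x (fun t => f t + g t) n = Lam m x f n + Lam m x g n := by
  simp [Lam, Finset.sum_add_distrib]

lemma Lam_smul (m : ℕ) (x : ℕ → ℕ → ℕ → ℝ) (f : ℝ → ℝ) (r : ℝ) (n : ℕ) :
    Lam m x (fun t => r * f t) n = r * Lam m x f n := by
  simp [Lam, Finset.mul_sum]

lemma Conv_poly (m : ℕ) (x : ℕ → ℕ → ℕ → ℝ) (hx : Good m x) (P : Polynomial ℝ) :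
    Conv m x (fun t => P.eval t) := by
  induction P using Polynomial.induction_on' with
  | add p q hp hq =>
    have := Filter.Tendsto.add hp hq
    rw [Conv]
    simp only [Polynomial.eval_add, Lam_add, add_div]
    rw [intervalIntegral.integral_add (p.continuous.intervalIntegrable _ _)
      (q.continuous.intervalIntegrable _ _), add_div]
    exact this
  | monomial j r =>
    have := Filter.Tendsto.const_mul r (Conv_pow m x hx j)
    rw [Conv]
    simp only [Polynomial.eval_monomial, Lam_smul, mul_div_assoc, intervalIntegral.integral_const_mul]
    exact this

lemma Good_le (m : ℕ) (x : ℕ → ℕ → ℕ → ℝ) (hx : Good m x) (n k i : ℕ) (h1 : m + 1 ≤ k)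
    (h2 : k < n + 1) (hi : i < n + 1 - k) : x n k i ∈ Set.Icc (-1:ℝ) 1 := by
  have := pA_root_le k (n + 1 - k) (by omega) (by omega) _ ((hx n k h1 h2).1 i hi)
  exact abs_le.mp this

lemma Lam_bound (m : ℕ) (x : ℕ → ℕ → ℕ → ℝ) (hx : Good m x) (f g : ℝ → ℝ) (δ : ℝ) (hδ : 0 ≤ δ)
    (h : ∀ t ∈ Set.Icc (-1:ℝ) 1, |f t - g t| ≤ δ) (n : ℕ) :
    |Lam m x f n - Lam m x g n| ≤ δ * ((n:ℝ) + 1) ^ 2 := by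
  rw [Lam, Lam, ← Finset.sum_sub_distrib]
  refine (Finset.abs_sum_le_sum_abs _ _).trans ?_
  have h1 : ∀ k ∈ Finset.Ico (m + 1) (n + 1), |∑ i ∈ Finset.range (n + 1 - k), f (x n k i) -
      ∑ i ∈ Finset.range (n + 1 - k), g (x n k i)| ≤ δ * ((n:ℝ) + 1) := by
    intro k hk
    rw [Finset.mem_Ico] at hk
    rw [← Finset.sum_sub_distrib]
    refine (Finset.abs_sum_le_sum_abs _ _).trans ?_
    refine (Finset.sum_le_card_nsmul _ _ δ ?_).trans ?_
    · intro i hi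
      exact h _ (Good_le m x hx n k i hk.1 hk.2 (Finset.mem_range.mp hi))
    · rw [nsmul_eq_mul, mul_comm, Finset.card_range]
      gcongr
      exact_mod_cast Nat.sub_le _ _
  refine (Finset.sum_le_card_nsmul _ _ _ h1).trans ?_
  rw [nsmul_eq_mul, Nat.card_Ico]
  have : ((n + 1 - (m + 1) : ℕ) : ℝ) ≤ (n:ℝ) + 1 := by exact_mod_cast Nat.sub_le _ _
  calc _ ≤ ((n:ℝ) + 1) * (δ * ((n:ℝ) + 1)) := by gcongr
    _ = _ := by ring

lemma Conv_cont (m : ℕ) (x : ℕ → ℕ → ℕ → ℝ) (hx : Good m x) (f : ℝ → ℝ) (hf : Continuous f) :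
    Conv m x f := by
  rw [Conv, Metric.tendsto_atTop]
  intro ε hε
  obtain ⟨P, hP⟩ := exists_polynomial_near_of_continuousOn (-1) 1 f hf.continuousOn (ε / 4) (by positivity)
  obtain ⟨n0, hn0⟩ := Metric.tendsto_atTop.mp (Conv_poly m x hx P) (ε / 4) (by positivity)
  refine ⟨n0, fun n hn => ?_⟩
  have a1 := hn0 n hn
  have a2 := Lam_bound m x hx f (fun t => P.eval t) (ε / 4) (by positivity)
    (fun t ht => by rw [abs_sub_comm]; exact (hP t ht).le) n
  have a3 : |(∫ t in (-1:ℝ)..1, P.eval t) - ∫ t in (-1:ℝ)..1, f t| ≤ ε / 4 * |1 - (-1)| := by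
    rw [← intervalIntegral.integral_sub (P.continuous.intervalIntegrable _ _)
      (hf.intervalIntegrable _ _)]
    rw [← Real.norm_eq_abs]
    apply intervalIntegral.norm_integral_le_of_norm_le_const
    intro t ht
    rw [Set.uIoc_of_le (by norm_num)] at ht
    exact (hP t ⟨ht.1.le, ht.2⟩).le
  rw [Real.dist_eq] at a1 ⊢
  have hp : (0:ℝ) < ((n:ℝ) + 1) ^ 2 := by positivity
  have a4 : |Lam m x f n / ((n:ℝ) + 1) ^ 2 - Lam m x (fun t => P.eval t) n / ((n:ℝ) + 1) ^ 2| ≤ ε / 4 := by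
    rw [← sub_div, abs_div, abs_of_pos hp, div_le_iff₀ hp]; exact a2
  norm_num at a3
  rw [abs_le] at a3 a4
  rw [abs_lt] at a1 ⊢
  constructor <;> linarith [a1.1, a1.2, a3.1, a3.2, a4.1, a4.2]

/-- trapezoid function -/
def tr (ε a c t : ℝ) : ℝ := max 0 (min 1 (min ((t - a) / ε) ((c - t) / ε)))

lemma tr_cont (ε a c : ℝ) : Continuous (tr ε a c) := by
  unfold tr; fun_prop

lemma tr_nonneg (ε a c t : ℝ) : 0 ≤ tr ε a c t := le_max_left _ _

lemma tr_le_one (ε a c t : ℝ) : tr ε a c t ≤ 1 := max_le zero_le_one (min_le_left _ _)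

lemma tr_zero (ε a c t : ℝ) (hε : 0 < ε) (h : t ≤ a ∨ c ≤ t) : tr ε a c t = 0 := by
  apply max_eq_left
  refine (min_le_right _ _).trans ?_
  rcases h with h | h
  · exact (min_le_left _ _).trans (div_nonpos_of_nonpos_of_nonneg (by linarith) hε.le)
  · exact (min_le_right _ _).trans (div_nonpos_of_nonpos_of_nonneg (by linarith) hε.le)

lemma tr_one (ε a c t : ℝ) (hε : 0 < ε) (h1 : a + ε ≤ t) (h2 : t ≤ c - ε) : tr ε a c t = 1 := by
  apply le_antisymm (tr_le_one _ _ _ _)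
  apply le_max_of_le_right
  refine le_min le_rfl (le_min ?_ ?_) <;> rw [le_div_iff₀ hε] <;> linarith

lemma tr_int_lower (ε a c : ℝ) (hε : 0 < ε) (ha : -1 ≤ a) (hc : c ≤ 1) (h : a + ε ≤ c - ε) :
    c - a - 2 * ε ≤ ∫ t in (-1:ℝ)..1, tr ε a c t := by
  have h1 : ∫ t in (a + ε)..(c - ε), tr ε a c t ≤ ∫ t in (-1:ℝ)..1, tr ε a c t := by
    apply intervalIntegral.integral_mono_interval (by linarith) h (by linarith)
    · exact Filter.Eventually.of_forall fun t => tr_nonneg _ _ _ _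
    · exact (tr_cont _ _ _).intervalIntegrable _ _
  have h2 : ∫ t in (a + ε)..(c - ε), tr ε a c t = ∫ t in (a + ε)..(c - ε), (1:ℝ) := by
    apply intervalIntegral.integral_congr
    intro t ht
    rw [Set.uIcc_of_le h] at ht
    exact tr_one _ _ _ _ hε ht.1 ht.2
  rw [h2, intervalIntegral.integral_const, smul_eq_mul, mul_one] at h1
  linarith

lemma tr_int_upper (ε a c : ℝ) (hε : 0 < ε) (hac : a ≤ c) (ha : a ≤ 1) (hc : -1 ≤ c) :
    ∫ t in (-1:ℝ)..1, tr ε a c t ≤ c - a := by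
  have hI : ∀ u v, IntervalIntegrable (tr ε a c) volume u v :=
    fun u v => (tr_cont _ _ _).intervalIntegrable _ _
  have h1 : ∫ t in (-1:ℝ)..1, tr ε a c t ≤ ∫ t in (a - 2)..(c + 2), tr ε a c t := by
    apply intervalIntegral.integral_mono_interval (by linarith) (by norm_num) (by linarith)
    · exact Filter.Eventually.of_forall fun t => tr_nonneg _ _ _ _
    · exact hI _ _
  rw [← intervalIntegral.integral_add_adjacent_intervals (hI (a - 2) a) (hI a (c + 2)),
    ← intervalIntegral.integral_add_adjacent_intervals (hI a c) (hI c (c + 2))] at h1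
  have h2 : ∫ t in (a - 2)..a, tr ε a c t = ∫ t in (a - 2)..a, (0:ℝ) := by
    apply intervalIntegral.integral_congr
    intro t ht
    rw [Set.uIcc_of_le (by linarith)] at ht
    exact tr_zero _ _ _ _ hε (Or.inl ht.2)
  have h3 : ∫ t in c..(c + 2), tr ε a c t = ∫ t in c..(c + 2), (0:ℝ) := by
    apply intervalIntegral.integral_congr
    intro t ht
    rw [Set.uIcc_of_le (by linarith)] at ht
    exact tr_zero _ _ _ _ hε (Or.inr ht.1)
  have h4 : ∫ t in a..c, tr ε a c t ≤ ∫ t in a..c, (1:ℝ) := by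
    apply intervalIntegral.integral_mono_on hac (hI _ _) (by simp)
    intro t _; exact tr_le_one _ _ _ _
  simp only [intervalIntegral.integral_const, smul_eq_mul, mul_zero, mul_one] at h2 h3 h4
  linarith

/-- indicator of `[a,c]` -/
def ind (a c t : ℝ) : ℝ := Set.indicator (Set.Icc a c) (fun _ => 1) t

lemma Lam_mono (m : ℕ) (x : ℕ → ℕ → ℕ → ℝ) (f g : ℝ → ℝ) (h : ∀ t, f t ≤ g t) (n : ℕ) :
    Lam m x f n ≤ Lam m x g n :=
  Finset.sum_le_sum fun _ _ => Finset.sum_le_sum fun _ _ => h _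

lemma Conv_ind (m : ℕ) (x : ℕ → ℕ → ℕ → ℝ) (hx : Good m x) (a c : ℝ) (ha : -1 ≤ a) (hac : a < c)
    (hc : c ≤ 1) :
    Filter.Tendsto (fun n : ℕ => Lam m x (ind a c) n / ((n:ℝ) + 1) ^ 2) Filter.atTop
      (nhds ((c - a) / 4)) := by
  rw [tendsto_order]
  constructor
  · intro y hy
    obtain ⟨ε, hε, h1, h2⟩ : ∃ ε > 0, ε ≤ (c - a) / 2 ∧ ε ≤ (c - a) / 4 - y :=
      ⟨min ((c - a) / 2) ((c - a) / 4 - y), lt_min (by linarith) (by linarith),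
        min_le_left _ _, min_le_right _ _⟩
    have hl := tr_int_lower ε a c hε ha hc (by linarith)
    have := (tendsto_order.mp (Conv_cont m x hx _ (tr_cont ε a c))).1 y (by linarith)
    filter_upwards [this] with n hn
    refine lt_of_lt_of_le hn ?_
    have : Lam m x (tr ε a c) n ≤ Lam m x (ind a c) n := by
      apply Lam_mono
      intro t
      by_cases ht : t ∈ Set.Icc a c
      · rw [ind, Set.indicator_of_mem ht]; exact tr_le_one _ _ _ _
      · rw [ind, Set.indicator_of_notMem ht]
        apply le_of_eq; apply tr_zero _ _ _ _ hε
        by_contra hh; push Not at hh; exact ht ⟨hh.1.le, hh.2.le⟩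
    gcongr
  · intro y hy
    obtain ⟨ε, hε, h1⟩ : ∃ ε > 0, ε ≤ y - (c - a) / 4 := ⟨y - (c - a) / 4, by linarith, le_rfl⟩
    have hl := tr_int_upper ε (a - ε) (c + ε) hε (by linarith) (by linarith) (by linarith)
    have := (tendsto_order.mp (Conv_cont m x hx _ (tr_cont ε (a - ε) (c + ε)))).2 y (by linarith)
    filter_upwards [this] with n hn
    refine lt_of_le_of_lt ?_ hn
    have : Lam m x (ind a c) n ≤ Lam m x (tr ε (a - ε) (c + ε)) n := by
      apply Lam_mono
      intro t
      by_cases ht : t ∈ Set.Icc a c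
      · rw [ind, Set.indicator_of_mem ht]
        rw [tr_one _ _ _ _ hε (by linarith [ht.1]) (by linarith [ht.2])]
      · rw [ind, Set.indicator_of_notMem ht]; exact tr_nonneg _ _ _ _
    gcongr

lemma sum_natAbs (F : ℕ → ℝ) (n : ℕ) :
    ∑ k ∈ Finset.Icc (-(n : ℤ)) (n : ℤ), F k.natAbs = F 0 + 2 * ∑ k ∈ Finset.Ico 1 (n + 1), F k := by
  induction n with
  | zero => simp
  | succ n ih =>
    have e : Finset.Icc (-((n + 1 : ℕ) : ℤ)) ((n + 1 : ℕ) : ℤ) =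
        insert ((n + 1 : ℕ) : ℤ) (insert (-((n + 1 : ℕ) : ℤ)) (Finset.Icc (-(n : ℤ)) (n : ℤ))) := by
      ext k; simp only [Finset.mem_Icc, Finset.mem_insert]; omega
    rw [e, Finset.sum_insert, Finset.sum_insert, ih, Finset.sum_Ico_succ_top (by omega : 1 ≤ n + 1)]
    · simp only [Int.natAbs_neg, Int.natAbs_natCast]; ring
    · simp only [Finset.mem_Icc]; omega
    · simp only [Finset.mem_Icc, Finset.mem_insert]; omega

/-- the distribution of the eigenvalues converges weakly to the uniform
distribution on `[−1,1]`: for `−1 ≤ a < c ≤ 1`,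
`#{(k,i) : x_{|k|,i} ∈ [a,c]} / N_n^m → (c−a)/2` as `n → ∞`. -/
theorem stmt18 (m : ℕ) (a c : ℝ) (ha : -1 ≤ a) (hac : a < c) (hc : c ≤ 1)
    (x : ℕ → ℕ → ℕ → ℝ)
    (hroot : ∀ n : ℕ, m ≤ n → ∀ k : ℕ, k ≤ n → ∀ i < Nk n m k,
      pA (k : ℝ) (m - k) (Nk n m k) (x n k i) = 0)
    (hinj : ∀ n : ℕ, m ≤ n → ∀ k : ℕ, k ≤ n → ∀ i < Nk n m k, ∀ i' < Nk n m k,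
      x n k i = x n k i' → i = i') :
    Filter.Tendsto
      (fun n : ℕ =>
        ((∑ k ∈ Finset.Icc (-(n : ℤ)) (n : ℤ),
            ((Finset.range (Nk n m k.natAbs)).filter
              (fun i => x n k.natAbs i ∈ Set.Icc a c)).card : ℕ) : ℝ) /
          ((((n + 1) ^ 2 - m ^ 2 : ℕ) : ℝ)))
      Filter.atTop (nhds ((c - a) / 2)) := by
  have hx : Good m x := by
    intro n k h1 h2
    have e : Nk n m k = n + 1 - k := by rw [Nk, max_eq_left (by omega)]; omega
    have e0 : m - k = 0 := by omega
    refine ⟨fun i hi => ?_, fun i hi i' hi' h => ?_⟩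
    · have := hroot n (by omega) k (by omega) i (by omega)
      rwa [e, e0] at this
    · exact hinj n (by omega) k (by omega) i (by omega) i' (by omega) h
  obtain ⟨F, hF⟩ : ∃ F : ℕ → ℕ → ℝ, ∀ n k, F n k =
      (((Finset.range (Nk n m k)).filter (fun i => x n k i ∈ Set.Icc a c)).card : ℝ) :=
    ⟨_, fun _ _ => rfl⟩
  obtain ⟨R, hRd⟩ : ∃ R : ℕ → ℝ, ∀ n, R n = F n 0 + 2 * ∑ k ∈ Finset.Ico 1 (m + 1), F n k :=
    ⟨_, fun _ => rfl⟩
  have hF0 : ∀ n k, 0 ≤ F n k := fun n k => by rw [hF]; exact Nat.cast_nonneg _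
  have hF1 : ∀ n k, F n k ≤ (n:ℝ) + 1 := by
    intro n k
    have h1 : ((Finset.range (Nk n m k)).filter (fun i => x n k i ∈ Set.Icc a c)).card ≤ n + 1 := by
      refine (Finset.card_filter_le _ _).trans ?_
      rw [Finset.card_range, Nk]; omega
    have h2 : ((((Finset.range (Nk n m k)).filter (fun i => x n k i ∈ Set.Icc a c)).card : ℕ) : ℝ) ≤ ((n + 1 : ℕ) : ℝ) :=
      Nat.cast_le.mpr h1
    rw [Nat.cast_add, Nat.cast_one] at h2
    rw [hF]; exact h2
  have hnum : ∀ n, m ≤ n → ((∑ k ∈ Finset.Icc (-(n : ℤ)) (n : ℤ),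
            ((Finset.range (Nk n m k.natAbs)).filter
              (fun i => x n k.natAbs i ∈ Set.Icc a c)).card : ℕ) : ℝ) =
      R n + 2 * Lam m x (ind a c) n := by
    intro n hn
    rw [Nat.cast_sum]
    simp only [← hF]
    refine (sum_natAbs (F n) n).trans ?_
    rw [← Finset.sum_Ico_consecutive _ (by omega : 1 ≤ m + 1) (by omega : m + 1 ≤ n + 1)]
    have hL : ∑ k ∈ Finset.Ico (m + 1) (n + 1), F n k = Lam m x (ind a c) n := by
      rw [Lam]
      apply Finset.sum_congr rfl
      intro k hk
      rw [Finset.mem_Ico] at hk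
      have e : Nk n m k = n + 1 - k := by rw [Nk, max_eq_left (by omega)]; omega
      simp only [hF, e, ind, Set.indicator_apply]
      rw [Finset.sum_boole]
    rw [hL]; rw [hRd]; ring
  have hR : Filter.Tendsto (fun n : ℕ => R n / ((n:ℝ) + 1) ^ 2) Filter.atTop (nhds 0) := by
    refine tendsto_helper R 0 (1 + 2 * m) 0 ?_
    intro n _
    have h1 : ∑ k ∈ Finset.Ico 1 (m + 1), F n k ≤ m * ((n:ℝ) + 1) := by
      refine (Finset.sum_le_card_nsmul _ _ _ (fun k _ => hF1 n k)).trans ?_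
      rw [nsmul_eq_mul, Nat.card_Ico, Nat.add_sub_cancel]
    have h2 : 0 ≤ ∑ k ∈ Finset.Ico 1 (m + 1), F n k := Finset.sum_nonneg fun k _ => hF0 n k
    have h3 := hF0 n 0
    have h4 := hF1 n 0
    have h5 : 0 ≤ R n := by rw [hRd]; linarith
    have h6 : R n ≤ (1 + 2 * m) * ((n:ℝ) + 1) := by rw [hRd]; linarith
    rw [mul_zero, sub_zero, abs_of_nonneg h5]
    exact h6
  have hD : Filter.Tendsto (fun n : ℕ => ((((n + 1) ^ 2 - m ^ 2 : ℕ) : ℝ)) / ((n:ℝ) + 1) ^ 2)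
      Filter.atTop (nhds 1) := by
    refine tendsto_helper _ 1 (m ^ 2) m ?_
    intro n hn
    have h1 : m ^ 2 ≤ (n + 1) ^ 2 := Nat.pow_le_pow_left (by omega) 2
    rw [Nat.cast_sub h1]
    push_cast
    have e : ((n:ℝ) + 1) ^ 2 - (m:ℝ) ^ 2 - ((n:ℝ) + 1) ^ 2 * 1 = - (m:ℝ) ^ 2 := by ring
    rw [e, abs_neg, abs_of_nonneg (by positivity)]
    apply le_mul_of_one_le_right (by positivity)
    linarith [(Nat.cast_nonneg n : (0:ℝ) ≤ n)]
  have hlim := (hR.add ((Conv_ind m x hx a c ha hac hc).const_mul 2)).div hD one_ne_zero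
  have e : (0 + 2 * ((c - a) / 4)) / 1 = (c - a) / 2 := by ring
  rw [e] at hlim
  refine hlim.congr' ?_
  filter_upwards [Filter.eventually_ge_atTop m] with n hn
  rw [hnum n hn]
  simp only [Pi.div_apply]
  have hp : ((n:ℝ) + 1) ^ 2 ≠ 0 := by positivity
  rw [← mul_div_assoc, ← add_div, div_div_div_cancel_right₀ hp]
end SFT
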